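/- Let h: [0,1] → [0,∞) be increasing and continuous with h(0) = 0, and suppose there exists a > 0 such that h(t) ≥ a·t for all t ∈ [0,1]. Then the integral ∫₀^{h(1)} s^{−2} h^{−1}(s) ds is finite if and only if ∫₀¹ (1/h(t)) dt is finite, where h^{−1} denotes the inverse function of h. -/

import Mathlib

open MeasureTheory Set

theorem lintegral_Ioo_ofReal_zpow_neg_two {c d : ℝ} (hc : 0 < c) (hcd : c ≤ d) :
    ∫⁻ s in Ioo c d, ENNReal.ofReal (s ^ (-2 : ℤ)) = ENNReal.ofReal (1 / c - 1 / d) := by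
  have h0 : (0 : ℝ) ∉ Set.uIcc c d := by
    rw [Set.uIcc_of_le hcd]
    exact fun h => absurd h.1 (not_le.2 hc)
  have hint : IntervalIntegrable (fun s : ℝ => s ^ (-2 : ℤ)) volume c d :=
    intervalIntegral.intervalIntegrable_zpow (Or.inr h0)
  rw [setLIntegral_congr Ioo_ae_eq_Ioc, ← ofReal_integral_eq_lintegral_ofReal
    ((intervalIntegrable_iff_integrableOn_Ioc_of_le hcd).1 hint)
    (Filter.Eventually.of_forall fun s => (even_two.neg.zpow_nonneg s)),
    ← intervalIntegral.integral_of_le hcd, integral_zpow (Or.inr ⟨by norm_num, h0⟩)]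
  congr 1
  norm_num
  ring

/-- Tonelli's theorem on the region `{(t, s) | h t < s}`, cut out of `(0, 1) × (0, h 1)`. -/
theorem lintegral_one_div_eq_lintegral_inverse_add
    {h hinv : ℝ → ℝ} (hmono : StrictMonoOn h (Icc (0 : ℝ) 1))
    (hcont : ContinuousOn h (Icc (0 : ℝ) 1)) (h0 : h 0 = 0)
    (hleft : ∀ t ∈ Icc (0 : ℝ) 1, hinv (h t) = t) :
    ∫⁻ t in Ioo (0 : ℝ) 1, ENNReal.ofReal (1 / h t) =
      (∫⁻ s in Ioo (0 : ℝ) (h 1), ENNReal.ofReal (s ^ (-2 : ℤ) * hinv s)) +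
        ENNReal.ofReal (1 / h 1) := by
  have m0 : (0 : ℝ) ∈ Icc (0 : ℝ) 1 := by simp
  have m1 : (1 : ℝ) ∈ Icc (0 : ℝ) 1 := by simp
  have hpos : ∀ t ∈ Ioo (0 : ℝ) 1, 0 < h t := fun t ht => by
    have := hmono m0 (Ioo_subset_Icc_self ht) ht.1
    rwa [h0] at this
  have hlt : ∀ t ∈ Ioo (0 : ℝ) 1, h t < h 1 := fun t ht =>
    hmono (Ioo_subset_Icc_self ht) m1 ht.2
  have hH : 0 < h 1 := by
    have := hmono m0 m1 one_pos
    rwa [h0] at this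
  obtain ⟨g, hg, hgh⟩ : ∃ g : ℝ → ℝ, Continuous g ∧ ∀ t ∈ Icc (0 : ℝ) 1, g t = h t :=
    ⟨IccExtend zero_le_one ((Icc (0 : ℝ) 1).domRestrict h),
      (continuousOn_iff_continuous_domRestrict.1 hcont).Icc_extend',
      fun t ht => IccExtend_of_mem _ _ ht⟩
  let F : ℝ × ℝ → ENNReal :=
    {p : ℝ × ℝ | g p.1 < p.2}.indicator fun p => ENNReal.ofReal (p.2 ^ (-2 : ℤ))
  have hF : Measurable F :=
    Measurable.indicator (by fun_prop)
      (measurableSet_lt (hg.measurable.comp measurable_fst) measurable_snd)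
  have inner_s : ∀ t ∈ Ioo (0 : ℝ) 1, ENNReal.ofReal (1 / h t) =
      (∫⁻ s in Ioo (0 : ℝ) (h 1), F (t, s)) + ENNReal.ofReal (1 / h 1) := fun t ht => by
    have e : (fun s => F (t, s)) =
        (Ioi (h t)).indicator fun s => ENNReal.ofReal (s ^ (-2 : ℤ)) := by
      ext s
      simp [F, indicator, hgh t (Ioo_subset_Icc_self ht)]
    have e' : Ioi (h t) ∩ Ioo 0 (h 1) = Ioo (h t) (h 1) := by
      ext s
      have := hpos t ht
      simp only [mem_inter_iff, mem_Ioi, mem_Ioo]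
      grind
    have hle := one_div_le_one_div_of_le (hpos t ht) (hlt t ht).le
    rw [e, setLIntegral_indicator measurableSet_Ioi, e',
      lintegral_Ioo_ofReal_zpow_neg_two (hpos t ht) (hlt t ht).le,
      ← ENNReal.ofReal_add (sub_nonneg.2 hle) (one_div_pos.2 hH).le, sub_add_cancel]
  have inner_t : ∀ s ∈ Ioo (0 : ℝ) (h 1), ENNReal.ofReal (s ^ (-2 : ℤ) * hinv s) =
      ∫⁻ t in Ioo (0 : ℝ) 1, F (t, s) := fun s hs => by
    obtain ⟨t₀, ht₀, rfl⟩ : s ∈ h '' Icc (0 : ℝ) 1 :=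
      intermediate_value_Icc zero_le_one hcont (by rw [h0]; exact Ioo_subset_Icc_self hs)
    have e : ∀ t ∈ Ioo (0 : ℝ) 1, F (t, h t₀) =
        (Iio t₀).indicator (fun _ => ENNReal.ofReal (h t₀ ^ (-2 : ℤ))) t := fun t ht => by
      have ht' := Ioo_subset_Icc_self ht
      simp [F, indicator, hgh t ht', hmono.lt_iff_lt ht' ht₀]
    have e' : Iio t₀ ∩ Ioo 0 1 = Ioo 0 t₀ := by
      ext t
      have := ht₀.2
      simp only [mem_inter_iff, mem_Iio, mem_Ioo]
      grind
    rw [setLIntegral_congr_fun measurableSet_Ioo e, setLIntegral_indicator measurableSet_Iio, e',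
      setLIntegral_const, Real.volume_Ioo, sub_zero, hleft t₀ ht₀,
      ENNReal.ofReal_mul (even_two.neg.zpow_nonneg _)]
  rw [setLIntegral_congr_fun measurableSet_Ioo inner_s,
    setLIntegral_congr_fun measurableSet_Ioo inner_t,
    lintegral_add_right _ measurable_const, setLIntegral_const, Real.volume_Ioo,
    lintegral_lintegral_swap (f := fun t s => F (t, s)) hF.aemeasurable]
  simp

/-- **Integration-by-parts step in the proof of Theorem 1(ii)**. Let `h : [0,1] → [0,∞)`
be increasing and continuous with `h(0) = 0` and `h(t) ≥ a·t` for some `a > 0`. Then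
`∫₀^{h(1)} s⁻² h⁻¹(s) ds < ∞` if and only if `∫₀¹ (1/h) < ∞`, where `h⁻¹` is the
inverse function of `h`. -/
theorem inverse_integral_finite_iff
    (h : ℝ → ℝ)
    (hh_nonneg : ∀ t ∈ Set.Icc (0:ℝ) 1, 0 ≤ h t)
    (hh_mono : StrictMonoOn h (Set.Icc (0:ℝ) 1))
    (hh_cont : ContinuousOn h (Set.Icc (0:ℝ) 1))
    (hh0 : h 0 = 0)
    (a : ℝ) (ha : 0 < a) (hha : ∀ t ∈ Set.Icc (0:ℝ) 1, a * t ≤ h t)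
    (hinv : ℝ → ℝ)
    (hinv_left : ∀ t ∈ Set.Icc (0:ℝ) 1, hinv (h t) = t)
    (hinv_right : ∀ s ∈ Set.Icc (0:ℝ) (h 1), h (hinv s) = s) :
    (∫⁻ s in Set.Ioo (0:ℝ) (h 1), ENNReal.ofReal (s ^ (-2 : ℤ) * hinv s) < ⊤) ↔
      (∫⁻ t in Set.Ioo (0:ℝ) 1, ENNReal.ofReal (1 / h t) < ⊤) := by
  rw [lintegral_one_div_eq_lintegral_inverse_add hh_mono hh_cont hh0 hinv_left,
    ENNReal.add_lt_top, and_iff_left ENNReal.ofReal_lt_top]
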